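/- There do not exist six spheres in ℝ³ that are pairwise externally tangent: there are no points c₁, …, c₆ ∈ ℝ³ and radii r₁, …, r₆ > 0 such that dist(cᵢ, cⱼ) = rᵢ + rⱼ for all i ≠ j. (Although the degree-of-freedom count N_F = 3N − N(N−1)/2 − 6 = −3 for N = 6 still leaves enough radii to adjust, this configuration of spheres does not exist.) -/

import Mathlib

/-- A family of `n ≠ 2` pairwise externally tangent spheres with centers `c i` and radii `r i` lifts
to a linearly independent family `(c i, ‖c i‖ ^ 2 - r i ^ 2, 1)`. -/
theorem linearIndependent_lift_of_dist_eq_add {ι E : Type*} [Fintype ι] [NormedAddCommGroup E]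
    [InnerProductSpace ℝ E] (hι : Fintype.card ι ≠ 2) (c : ι → E) (r : ι → ℝ)
    (hr : ∀ i, 0 < r i) (hd : ∀ i j, i ≠ j → dist (c i) (c j) = r i + r j) :
    LinearIndependent ℝ (fun i ↦ (c i, ‖c i‖ ^ 2 - r i ^ 2, (1 : ℝ))) := by
  classical
  rw [Fintype.linearIndependent_iff]
  intro l hl
  have hc : ∑ i, l i • c i = 0 := by simpa [Prod.fst_sum] using congrArg Prod.fst hl
  have hs : ∑ i, l i * (‖c i‖ ^ 2 - r i ^ 2) = 0 := by
    simpa [Prod.fst_sum, Prod.snd_sum] using congrArg (fun p ↦ p.2.1) hl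
  have h1 : ∑ i, l i = 0 := by
    simpa [Prod.snd_sum] using congrArg (fun p ↦ p.2.2) hl
  have gram (i j : ι) : (‖c i‖ ^ 2 - r i ^ 2) + (‖c j‖ ^ 2 - r j ^ 2) - 2 * inner ℝ (c i) (c j)
      = 2 * r i * r j - if i = j then 4 * r j ^ 2 else 0 := by
    split_ifs with h
    · subst h
      rw [real_inner_self_eq_norm_sq]
      ring
    · have := norm_sub_sq_real (c i) (c j)
      rw [← dist_eq_norm, hd i j h] at this
      linarith
  have key (j : ι) : ∑ i, l i * r i = 2 * (l j * r j) := by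
    have hin : ∑ i, l i * inner ℝ (c i) (c j) = 0 := by
      simpa [sum_inner, real_inner_smul_left] using congrArg (fun v ↦ inner ℝ v (c j)) hc
    have hzero : ∑ i, l i * ((‖c i‖ ^ 2 - r i ^ 2) + (‖c j‖ ^ 2 - r j ^ 2)
        - 2 * inner ℝ (c i) (c j)) = 0 := by
      calc _ = ∑ i, l i * (‖c i‖ ^ 2 - r i ^ 2) + (∑ i, l i) * (‖c j‖ ^ 2 - r j ^ 2)
            - 2 * ∑ i, l i * inner ℝ (c i) (c j) := by
              rw [Finset.sum_mul, Finset.mul_sum, ← Finset.sum_add_distrib,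
                ← Finset.sum_sub_distrib]
              exact Finset.sum_congr rfl fun i _ ↦ by ring
        _ = 0 := by rw [hs, h1, hin]; ring
    have hdiag : ∑ i, l i * (2 * r i * r j - if i = j then 4 * r j ^ 2 else 0)
        = 2 * r j * (∑ i, l i * r i - 2 * (l j * r j)) := by
      simp only [mul_sub, Finset.sum_sub_distrib, mul_ite, mul_zero, Finset.sum_ite_eq',
        Finset.mem_univ, if_true, Finset.mul_sum]
      congr 1
      · exact Finset.sum_congr rfl fun i _ ↦ by ring
      · ring
    simp only [gram, hdiag] at hzero
    have := (mul_eq_zero.mp hzero).resolve_left (by have := hr j; positivity)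
    linarith
  have hcard : ((Fintype.card ι : ℝ) - 2) * ∑ i, l i * r i = 0 := by
    have := Finset.sum_congr (rfl : (Finset.univ : Finset ι) = Finset.univ) fun j _ ↦ key j
    rw [Finset.sum_const, Finset.card_univ, nsmul_eq_mul, ← Finset.mul_sum] at this
    linarith
  have hsum : ∑ i, l i * r i = 0 :=
    (mul_eq_zero.mp hcard).resolve_left (sub_ne_zero.mpr (by exact_mod_cast hι))
  intro j
  have := key j
  exact (mul_eq_zero.mp (by linarith : l j * r j = 0)).resolve_right (hr j).ne'

/-- There are no six pairwise externally tangent spheres in `ℝ³`. -/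
theorem stmt13 :
    ¬ ∃ (c : Fin 6 → EuclideanSpace ℝ (Fin 3)) (r : Fin 6 → ℝ),
        (∀ i, 0 < r i) ∧
        (∀ i j, i ≠ j → dist (c i) (c j) = r i + r j) := by
  rintro ⟨c, r, hr, hd⟩
  have h := (linearIndependent_lift_of_dist_eq_add (by simp) c r hr hd).fintype_card_le_finrank
  simp at h
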